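/- Let ρ_ABC be a state on H_A ⊗ H_B ⊗ H_C and suppose ρ_ABC = ∑_{k=1}^K p_k ρ^k_ABC where {p_k} is a probability distribution and each ρ^k_ABC is a state on H_A ⊗ H_B ⊗ H_C. Then T^(a)(ρ_ABC) ≥ ∑_{k=1}^K p_k T^(a)(ρ^k_ABC), i.e. T^(a) is concave on states. -/

import Mathlib

open Matrix Kronecker
open scoped Classical ComplexOrder

noncomputable section

/-- A state (density operator): positive semidefinite with unit trace. -/
def IsState {n : Type*} [Fintype n] (ρ : Matrix n n ℂ) : Prop :=
  ρ.PosSemidef ∧ ρ.trace = 1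

/-- A unit vector. -/
def UnitVec {n : Type*} [Fintype n] (ψ : n → ℂ) : Prop :=
  ∑ i, Complex.normSq (ψ i) = 1

/-- The rank-one projection `|ψ⟩⟨ψ|`. -/
def pureSt {n : Type*} (ψ : n → ℂ) : Matrix n n ℂ :=
  Matrix.vecMulVec ψ (star ψ)

/-- Von Neumann entropy `S(ρ) = -Tr(ρ log ρ)`, computed via the eigenvalues of a
Hermitian matrix (with the convention `0 log 0 = 0`, and junk value `0` on
non-Hermitian input). -/
def entropy {n : Type*} [Fintype n] [DecidableEq n] (ρ : Matrix n n ℂ) : ℝ :=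
  if h : ρ.IsHermitian then -∑ i, h.eigenvalues i * Real.log (h.eigenvalues i) else 0

/-- Partial trace over the second tensor factor. -/
def ptraceRight {X Y : Type*} [Fintype Y] (ρ : Matrix (X × Y) (X × Y) ℂ) :
    Matrix X X ℂ :=
  fun x x' => ∑ y, ρ (x, y) (x', y)

/-- Partial trace over the first tensor factor. -/
def ptraceLeft {X Y : Type*} [Fintype X] (ρ : Matrix (X × Y) (X × Y) ℂ) :
    Matrix Y Y ℂ :=
  fun y y' => ∑ x, ρ (x, y) (x, y')

/-- Marginal `ρ_AB` of a tripartite state. -/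
def margAB {A B C : Type*} [Fintype C] (ρ : Matrix (A × B × C) (A × B × C) ℂ) :
    Matrix (A × B) (A × B) ℂ :=
  fun x y => ∑ c, ρ (x.1, x.2, c) (y.1, y.2, c)

/-- Marginal `ρ_AC` of a tripartite state. -/
def margAC {A B C : Type*} [Fintype B] (ρ : Matrix (A × B × C) (A × B × C) ℂ) :
    Matrix (A × C) (A × C) ℂ :=
  fun x y => ∑ b, ρ (x.1, b, x.2) (y.1, b, y.2)

/-- Marginal `ρ_BC` of a tripartite state. -/
def margBC {A B C : Type*} [Fintype A] (ρ : Matrix (A × B × C) (A × B × C) ℂ) :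
    Matrix (B × C) (B × C) ℂ :=
  fun x y => ∑ a, ρ (a, x.1, x.2) (a, y.1, y.2)

/-- Marginal `ρ_A` of a tripartite state. -/
def margA {A B C : Type*} [Fintype B] [Fintype C]
    (ρ : Matrix (A × B × C) (A × B × C) ℂ) : Matrix A A ℂ :=
  fun a a' => ∑ b, ∑ c, ρ (a, b, c) (a', b, c)

/-- Marginal `ρ_B` of a tripartite state. -/
def margB {A B C : Type*} [Fintype A] [Fintype C]
    (ρ : Matrix (A × B × C) (A × B × C) ℂ) : Matrix B B ℂ :=
  fun b b' => ∑ a, ∑ c, ρ (a, b, c) (a, b', c)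

/-- Marginal `ρ_C` of a tripartite state. -/
def margC {A B C : Type*} [Fintype A] [Fintype B]
    (ρ : Matrix (A × B × C) (A × B × C) ℂ) : Matrix C C ℂ :=
  fun c c' => ∑ a, ∑ b, ρ (a, b, c) (a, b, c')

/-- `T^(a)(ρ_ABC) = S(ρ_AB) + S(ρ_AC) − S(ρ_B) − S(ρ_C)`, the deviation from
saturation of strong subadditivity. -/
def Ta {A B C : Type*} [Fintype A] [Fintype B] [Fintype C]
    [DecidableEq A] [DecidableEq B] [DecidableEq C]
    (ρ : Matrix (A × B × C) (A × B × C) ℂ) : ℝ :=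
  entropy (margAB ρ) + entropy (margAC ρ) - entropy (margB ρ) - entropy (margC ρ)

/-- Entanglement of formation of a bipartite state (infimum over pure-state
ensembles realizing `ρ`). -/
def eof {X Y : Type*} [Fintype X] [Fintype Y] [DecidableEq X]
    (ρ : Matrix (X × Y) (X × Y) ℂ) : ℝ :=
  sInf { e : ℝ | ∃ (K : ℕ) (p : Fin K → ℝ) (ψ : Fin K → X × Y → ℂ),
    (∀ i, 0 ≤ p i) ∧ (∀ i, UnitVec (ψ i)) ∧
    ρ = ∑ i, p i • pureSt (ψ i) ∧
    e = ∑ i, p i * entropy (ptraceRight (pureSt (ψ i))) }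

/-- Probability of obtaining the outcome of the rank-one projector `|u⟩⟨u|`
measured on the second subsystem. -/
def measProb {X Y : Type*} [Fintype X] [Fintype Y] [DecidableEq X]
    (ρ : Matrix (X × Y) (X × Y) ℂ) (u : Y → ℂ) : ℝ :=
  ((((1 : Matrix X X ℂ) ⊗ₖ pureSt u) * ρ).trace).re

/-- Post-measurement state of the first subsystem after obtaining the outcome
of the rank-one projector `|u⟩⟨u|` on the second subsystem. -/
def postState {X Y : Type*} [Fintype X] [Fintype Y] [DecidableEq X]
    (ρ : Matrix (X × Y) (X × Y) ℂ) (u : Y → ℂ) : Matrix X X ℂ :=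
  (measProb ρ u)⁻¹ •
    ptraceRight (((1 : Matrix X X ℂ) ⊗ₖ pureSt u) * ρ * ((1 : Matrix X X ℂ) ⊗ₖ pureSt u))

/-- Classical correlation `J^(Y)(ρ_XY)`: supremum over complete families of
mutually orthogonal rank-one projectors on `H_Y` (parametrized by orthonormal
bases `v` of `H_Y`) of `S(ρ_X) − ∑ᵢ pᵢ S(ρ_{X|i})`. -/
def classicalCorr {X Y : Type*} [Fintype X] [Fintype Y] [DecidableEq X] [DecidableEq Y]
    (ρ : Matrix (X × Y) (X × Y) ℂ) : ℝ :=
  sSup { r : ℝ | ∃ v : Y → Y → ℂ,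
    (∀ i j, star (v i) ⬝ᵥ v j = if i = j then 1 else 0) ∧
    r = entropy (ptraceRight ρ) - ∑ i, measProb ρ (v i) * entropy (postState ρ (v i)) }

/-- Quantum mutual information `I(ρ_XY) = S(ρ_X) + S(ρ_Y) − S(ρ_XY)`. -/
def mutualInfo {X Y : Type*} [Fintype X] [Fintype Y] [DecidableEq X] [DecidableEq Y]
    (ρ : Matrix (X × Y) (X × Y) ℂ) : ℝ :=
  entropy (ptraceRight ρ) + entropy (ptraceLeft ρ) - entropy ρ

/-- Quantum discord `D^(Y)(ρ_XY)` with measurement on the second subsystem. -/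
def discord {X Y : Type*} [Fintype X] [Fintype Y] [DecidableEq X] [DecidableEq Y]
    (ρ : Matrix (X × Y) (X × Y) ℂ) : ℝ :=
  mutualInfo ρ - classicalCorr ρ

/-- Quantum conditional entropy `S(X|Y) = S(ρ_XY) − S(ρ_Y)`. -/
def condEnt {X Y : Type*} [Fintype X] [Fintype Y] [DecidableEq X] [DecidableEq Y]
    (ρ : Matrix (X × Y) (X × Y) ℂ) : ℝ :=
  entropy ρ - entropy (ptraceLeft ρ)

/-- Marginal `ρ_{AB̃}` (`B̃ = BE`) of a four-partite state on `A × B × C × E`. -/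
def margABE {A B C E : Type*} [Fintype C]
    (Ψ : Matrix (A × B × C × E) (A × B × C × E) ℂ) :
    Matrix (A × B × E) (A × B × E) ℂ :=
  fun x y => ∑ c, Ψ (x.1, x.2.1, c, x.2.2) (y.1, y.2.1, c, y.2.2)

/-- Marginal `ρ_{AC̃}` (`C̃ = CE`) of a four-partite state on `A × B × C × E`. -/
def margACE {A B C E : Type*} [Fintype B]
    (Ψ : Matrix (A × B × C × E) (A × B × C × E) ℂ) :
    Matrix (A × C × E) (A × C × E) ℂ :=
  fun x y => ∑ b, Ψ (x.1, b, x.2.1, x.2.2) (y.1, b, y.2.1, y.2.2)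

/-- Marginal `ρ_ABC` of a four-partite state on `A × B × C × E` (trace out `E`). -/
def margABC {A B C E : Type*} [Fintype E]
    (Ψ : Matrix (A × B × C × E) (A × B × C × E) ℂ) :
    Matrix (A × B × C) (A × B × C) ℂ :=
  fun x y => ∑ e, Ψ (x.1, x.2.1, x.2.2, e) (y.1, y.2.1, y.2.2, e)

/-- Reordering `(A ⊗ (B^L ⊗ C^L)) ⊗ (B^R ⊗ C^R) ≃ A ⊗ (B^L ⊗ B^R) ⊗ (C^L ⊗ C^R)`. -/
def reindexYZ (A BL BR CL CR : Type*) :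
    (A × (BL × CL)) × (BR × CR) ≃ A × (BL × BR) × (CL × CR) where
  toFun x := (x.1.1, (x.1.2.1, x.2.1), (x.1.2.2, x.2.2))
  invFun x := ((x.1, (x.2.1.1, x.2.2.1)), (x.2.1.2, x.2.2.2))
  left_inv := by rintro ⟨⟨a, bl, cl⟩, br, cr⟩; rfl
  right_inv := by rintro ⟨a, ⟨bl, br⟩, cl, cr⟩; rfl


/-- `ρ = U diag(p) U*` with `U` unitary. -/
structure IsSpectralDecomp {n : Type*} [Fintype n] [DecidableEq n]
    (ρ U : Matrix n n ℂ) (p : n → ℝ) : Prop where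
  unitary : Uᴴ * U = 1
  eq : ρ = U * diagonal (fun i => (p i : ℂ)) * Uᴴ

theorem Matrix.IsHermitian.isSpectralDecomp {n : Type*} [Fintype n] [DecidableEq n]
    {ρ : Matrix n n ℂ} (h : ρ.IsHermitian) :
    IsSpectralDecomp ρ (h.eigenvectorUnitary : Matrix n n ℂ) h.eigenvalues where
  unitary := Unitary.coe_star_mul_self h.eigenvectorUnitary
  eq := by
    have := h.spectral_theorem
    rw [Unitary.conjStarAlgAut_apply] at this
    exact this

namespace IsSpectralDecomp

variable {n : Type*} [Fintype n] [DecidableEq n] {ρ σ U V : Matrix n n ℂ} {p q : n → ℝ}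

theorem trace_re (h : IsSpectralDecomp ρ U p) : ρ.trace.re = ∑ i, p i := by
  rw [h.eq, Matrix.trace_mul_comm, ← Matrix.mul_assoc, h.unitary, Matrix.one_mul,
    Matrix.trace_diagonal, Complex.re_sum]
  simp

theorem unitary' (h : IsSpectralDecomp ρ U p) : U * Uᴴ = 1 :=
  mul_eq_one_comm.mp h.unitary

theorem sum_normSq_overlap (hρ : IsSpectralDecomp ρ U p) (hσ : IsSpectralDecomp σ V q) (i : n) :
    ∑ j, Complex.normSq ((Uᴴ * V) i j) = 1 := by
  have h : (Uᴴ * V) * (Uᴴ * V)ᴴ = 1 := by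
    rw [conjTranspose_mul, conjTranspose_conjTranspose, Matrix.mul_assoc, ← Matrix.mul_assoc V,
      hσ.unitary', Matrix.one_mul, hρ.unitary]
  have h1 := congrArg Complex.re (congrFun (congrFun h i) i)
  rw [Matrix.mul_apply, Complex.re_sum] at h1
  simpa [conjTranspose_apply, Complex.mul_conj, -Complex.mul_re] using h1

/-- Diagonal entries of `V* ρ V` in terms of the overlaps of the two eigenbases. -/
theorem conj_apply_self_re (hρ : IsSpectralDecomp ρ U p) (V : Matrix n n ℂ) (j : n) :
    ((Vᴴ * ρ * V) j j).re = ∑ i, Complex.normSq ((Uᴴ * V) i j) * p i := by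
  have h : Vᴴ * ρ * V = (Uᴴ * V)ᴴ * diagonal (fun i => (p i : ℂ)) * (Uᴴ * V) := by
    rw [hρ.eq]
    simp [conjTranspose_mul, Matrix.mul_assoc]
  rw [h, Matrix.mul_apply, Complex.re_sum]
  refine Finset.sum_congr rfl fun i _ => ?_
  rw [Matrix.mul_diagonal, conjTranspose_apply]
  simp [Complex.normSq_apply]
  ring

end IsSpectralDecomp

/-- A real functional, linear in `(ρ, σ)`, whose supremum over `Y` is
`⟨ρ, (R_σ + t L_ρ)⁻¹ ρ⟩`, with `L` and `R` left and right multiplication. -/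
def variationalForm {n : Type*} [Fintype n] (t : ℝ) (Y ρ σ : Matrix n n ℂ) : ℝ :=
  2 * (Yᴴ * ρ).trace.re - (Y * σ * Yᴴ).trace.re - t * (Yᴴ * ρ * Y).trace.re

theorem variationalForm_sum {n ι : Type*} [Fintype n] [Fintype ι] (t : ℝ) (Y : Matrix n n ℂ)
    (w : ι → ℝ) (ρ σ : ι → Matrix n n ℂ) :
    variationalForm t Y (∑ k, w k • ρ k) (∑ k, w k • σ k) =
      ∑ k, w k * variationalForm t Y (ρ k) (σ k) := by
  simp only [variationalForm, Matrix.sum_mul, Matrix.mul_smul, Matrix.smul_mul,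
    Matrix.trace_sum, Matrix.trace_smul, Complex.re_sum, Complex.smul_re, smul_eq_mul,
    Finset.mul_sum, mul_sub, Finset.sum_sub_distrib]
  congr 1
  · congr 1
    exact Finset.sum_congr rfl fun k _ => by ring
  · exact Finset.sum_congr rfl fun k _ => by ring

/-- The eigenbasis expression of `⟨ρ, (R_σ + t L_ρ)⁻¹ ρ⟩`. -/
def resolventForm {n : Type*} [Fintype n] (U V : Matrix n n ℂ) (p q : n → ℝ) (t : ℝ) : ℝ :=
  ∑ i, ∑ j, Complex.normSq ((Uᴴ * V) i j) * (p i * (p i / (q j + t * p i)))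

/-- The integral of `resolventForm` over `[0, t]`. -/
def logForm {n : Type*} [Fintype n] (U V : Matrix n n ℂ) (p q : n → ℝ) (t : ℝ) : ℝ :=
  ∑ i, ∑ j, Complex.normSq ((Uᴴ * V) i j) *
    (p i * (Real.log (q j + t * p i) - Real.log (q j)))

/-- The relative entropy `Tr ρ log ρ - Tr ρ log σ` in terms of spectral decompositions. -/
def relEntForm {n : Type*} [Fintype n] (U V : Matrix n n ℂ) (p q : n → ℝ) : ℝ :=
  ∑ i, ∑ j, Complex.normSq ((Uᴴ * V) i j) * (p i * (Real.log (p i) - Real.log (q j)))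

theorem hasDerivAt_logForm {n : Type*} [Fintype n] (U V : Matrix n n ℂ) {p q : n → ℝ}
    (hp : ∀ i, 0 ≤ p i) (hq : ∀ j, 0 < q j) {t : ℝ} (ht : 0 ≤ t) :
    HasDerivAt (logForm U V p q) (resolventForm U V p q t) t := by
  unfold logForm resolventForm
  refine HasDerivAt.fun_sum fun i _ => HasDerivAt.fun_sum fun j _ => ?_
  refine HasDerivAt.const_mul _ (HasDerivAt.const_mul _ (HasDerivAt.sub_const _ ?_))
  have hd : q j + t * p i ≠ 0 := (add_pos_of_pos_of_nonneg (hq j) (mul_nonneg ht (hp i))).ne'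
  have h := ((hasDerivAt_id t).mul_const (p i)).const_add (q j)
  simpa using h.log hd

theorem logForm_zero {n : Type*} [Fintype n] (U V : Matrix n n ℂ) (p q : n → ℝ) :
    logForm U V p q 0 = 0 := by
  simp [logForm]

section Convexity

variable {n : Type*} [Fintype n] [DecidableEq n] {ρ σ U V : Matrix n n ℂ} {p q : n → ℝ}

theorem variationalForm_eq (hρ : IsSpectralDecomp ρ U p) (hσ : IsSpectralDecomp σ V q)
    (t : ℝ) (Z : Matrix n n ℂ) :
    variationalForm t (U * Z * Vᴴ) ρ σ = ∑ i, ∑ j,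
      (2 * p i * (star (Z i j) * (Uᴴ * V) i j).re - (q j + t * p i) * Complex.normSq (Z i j)) := by
  have h1 : ((U * Z * Vᴴ)ᴴ * ρ).trace =
      (Zᴴ * (diagonal (fun i => (p i : ℂ)) * (Uᴴ * V))).trace := by
    rw [hρ.eq]
    simp only [conjTranspose_mul, conjTranspose_conjTranspose, Matrix.mul_assoc]
    rw [Matrix.trace_mul_comm]
    simp only [Matrix.mul_assoc]
    rw [← Matrix.mul_assoc Uᴴ U, hρ.unitary, Matrix.one_mul]
  have h2 : (U * Z * Vᴴ * σ * (U * Z * Vᴴ)ᴴ).trace =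
      (Z * (diagonal (fun i => (q i : ℂ)) * Zᴴ)).trace := by
    rw [hσ.eq]
    simp only [conjTranspose_mul, conjTranspose_conjTranspose, Matrix.mul_assoc]
    rw [Matrix.trace_mul_comm]
    simp only [Matrix.mul_assoc]
    rw [hρ.unitary, ← Matrix.mul_assoc Vᴴ V, ← Matrix.mul_assoc Vᴴ V, hσ.unitary]
    simp only [Matrix.one_mul, Matrix.mul_one]
  have h3 : ((U * Z * Vᴴ)ᴴ * ρ * (U * Z * Vᴴ)).trace =
      (Zᴴ * (diagonal (fun i => (p i : ℂ)) * Z)).trace := by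
    rw [hρ.eq]
    simp only [conjTranspose_mul, conjTranspose_conjTranspose, Matrix.mul_assoc]
    rw [Matrix.trace_mul_comm]
    simp only [Matrix.mul_assoc]
    rw [hσ.unitary, ← Matrix.mul_assoc Uᴴ U, ← Matrix.mul_assoc Uᴴ U, hρ.unitary]
    simp only [Matrix.one_mul, Matrix.mul_one]
  have e1 : ((U * Z * Vᴴ)ᴴ * ρ).trace.re =
      ∑ i, ∑ j, p i * (star (Z i j) * (Uᴴ * V) i j).re := by
    rw [h1, Matrix.trace, Complex.re_sum, Finset.sum_comm]
    refine Finset.sum_congr rfl fun j _ => ?_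
    rw [Matrix.diag_apply, Matrix.mul_apply, Complex.re_sum]
    refine Finset.sum_congr rfl fun i _ => ?_
    rw [Matrix.diagonal_mul, conjTranspose_apply]
    simp
    ring
  have e2 : (U * Z * Vᴴ * σ * (U * Z * Vᴴ)ᴴ).trace.re =
      ∑ i, ∑ j, q j * Complex.normSq (Z i j) := by
    rw [h2, Matrix.trace, Complex.re_sum]
    refine Finset.sum_congr rfl fun i _ => ?_
    rw [Matrix.diag_apply, Matrix.mul_apply, Complex.re_sum]
    refine Finset.sum_congr rfl fun j _ => ?_
    rw [Matrix.diagonal_mul, conjTranspose_apply]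
    simp [Complex.normSq_apply]
    ring
  have e3 : ((U * Z * Vᴴ)ᴴ * ρ * (U * Z * Vᴴ)).trace.re =
      ∑ i, ∑ j, p i * Complex.normSq (Z i j) := by
    rw [h3, Matrix.trace, Complex.re_sum, Finset.sum_comm]
    refine Finset.sum_congr rfl fun j _ => ?_
    rw [Matrix.diag_apply, Matrix.mul_apply, Complex.re_sum]
    refine Finset.sum_congr rfl fun i _ => ?_
    rw [Matrix.diagonal_mul, conjTranspose_apply]
    simp [Complex.normSq_apply]
    ring
  rw [variationalForm, e1, e2, e3]
  simp only [Finset.mul_sum, ← Finset.sum_sub_distrib]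
  exact Finset.sum_congr rfl fun i _ => Finset.sum_congr rfl fun j _ => by ring

theorem variationalForm_le (hρ : IsSpectralDecomp ρ U p) (hσ : IsSpectralDecomp σ V q)
    (hp : ∀ i, 0 ≤ p i) (hq : ∀ j, 0 < q j) {t : ℝ} (ht : 0 ≤ t) (Y : Matrix n n ℂ) :
    variationalForm t Y ρ σ ≤ resolventForm U V p q t := by
  have hY : Y = U * (Uᴴ * Y * V) * Vᴴ := by
    simp only [Matrix.mul_assoc, hσ.unitary', Matrix.mul_one]
    rw [← Matrix.mul_assoc, hρ.unitary', Matrix.one_mul]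
  rw [hY, variationalForm_eq hρ hσ]
  refine Finset.sum_le_sum fun i _ => Finset.sum_le_sum fun j _ => ?_
  generalize (Uᴴ * Y * V) i j = z
  generalize (Uᴴ * V) i j = u
  have hd : 0 < q j + t * p i := add_pos_of_pos_of_nonneg (hq j) (mul_nonneg ht (hp i))
  generalize q j + t * p i = d at hd
  have h : Complex.normSq u * (p i * (p i / d)) -
      (2 * p i * (star z * u).re - d * Complex.normSq z) =
      ((p i * u.re - d * z.re) ^ 2 + (p i * u.im - d * z.im) ^ 2) / d := by
    simp [Complex.normSq_apply]
    field_simp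
    ring
  have : 0 ≤ ((p i * u.re - d * z.re) ^ 2 + (p i * u.im - d * z.im) ^ 2) / d := by positivity
  linarith

theorem exists_variationalForm_eq (hρ : IsSpectralDecomp ρ U p) (hσ : IsSpectralDecomp σ V q)
    (hp : ∀ i, 0 ≤ p i) (hq : ∀ j, 0 < q j) {t : ℝ} (ht : 0 ≤ t) :
    ∃ Y, variationalForm t Y ρ σ = resolventForm U V p q t := by
  refine ⟨U * (Matrix.of fun i j => ((p i / (q j + t * p i) : ℝ) : ℂ) * (Uᴴ * V) i j) * Vᴴ, ?_⟩
  rw [variationalForm_eq hρ hσ]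
  refine Finset.sum_congr rfl fun i _ => Finset.sum_congr rfl fun j _ => ?_
  rw [Matrix.of_apply]
  generalize (Uᴴ * V) i j = u
  have hd : 0 < q j + t * p i := add_pos_of_pos_of_nonneg (hq j) (mul_nonneg ht (hp i))
  generalize q j + t * p i = d at hd
  have h1 : (star (((p i / d : ℝ) : ℂ) * u) * u).re = p i / d * Complex.normSq u := by
    rw [star_mul', Complex.star_def, Complex.conj_ofReal, mul_assoc, Complex.re_ofReal_mul]
    simp [Complex.normSq_apply]
  rw [h1, Complex.normSq_mul, Complex.normSq_ofReal]
  field_simp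
  ring

theorem tendsto_logForm (hρ : IsSpectralDecomp ρ U p) (hσ : IsSpectralDecomp σ V q)
    (hp : ∀ i, 0 ≤ p i) :
    Filter.Tendsto (fun t => logForm U V p q t - ρ.trace.re * Real.log t) Filter.atTop
      (nhds (relEntForm U V p q)) := by
  have h : ∀ t, logForm U V p q t - ρ.trace.re * Real.log t =
      ∑ i, ∑ j, Complex.normSq ((Uᴴ * V) i j) *
        (p i * ((Real.log (q j + t * p i) - Real.log t) - Real.log (q j))) := by
    intro t
    have : ρ.trace.re * Real.log t =
        ∑ i, ∑ j, Complex.normSq ((Uᴴ * V) i j) * (p i * Real.log t) := by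
      simp only [← Finset.sum_mul, hρ.sum_normSq_overlap hσ, one_mul, hρ.trace_re]
    rw [this, logForm]
    simp only [← Finset.sum_sub_distrib]
    exact Finset.sum_congr rfl fun i _ => Finset.sum_congr rfl fun j _ => by ring
  simp only [h]
  unfold relEntForm
  refine tendsto_finsetSum _ fun i _ => tendsto_finsetSum _ fun j _ => ?_
  refine Filter.Tendsto.const_mul _ ?_
  rcases (hp i).eq_or_lt with h0 | h0
  · simp [← h0]
  refine Filter.Tendsto.const_mul _ (Filter.Tendsto.sub_const ?_ _)
  have hlim : Filter.Tendsto (fun t : ℝ => q j / t + p i) Filter.atTop (nhds (p i)) := by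
    simpa using (Filter.tendsto_id.const_div_atTop (q j)).add_const (p i)
  refine (hlim.log h0.ne').congr' ?_
  filter_upwards [Filter.eventually_gt_atTop 0, hlim.eventually (lt_mem_nhds h0)] with t ht ht'
  have : q j + t * p i = (q j / t + p i) * t := by field_simp
  rw [this, Real.log_mul ht'.ne' ht.ne']
  ring

/-- Joint convexity of the quantum relative entropy. -/
theorem relEntForm_convex {ι : Type*} [Fintype ι] {w : ι → ℝ} (hw : ∀ k, 0 ≤ w k)
    {ρs σs Us Vs : ι → Matrix n n ℂ} {ps qs : ι → n → ℝ}
    (hρ : IsSpectralDecomp ρ U p) (hσ : IsSpectralDecomp σ V q)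
    (hρs : ∀ k, IsSpectralDecomp (ρs k) (Us k) (ps k))
    (hσs : ∀ k, IsSpectralDecomp (σs k) (Vs k) (qs k))
    (hp : ∀ i, 0 ≤ p i) (hq : ∀ j, 0 < q j)
    (hps : ∀ k i, 0 ≤ ps k i) (hqs : ∀ k j, 0 < qs k j)
    (hρ_sum : ρ = ∑ k, w k • ρs k) (hσ_sum : σ = ∑ k, w k • σs k) :
    relEntForm U V p q ≤ ∑ k, w k * relEntForm (Us k) (Vs k) (ps k) (qs k) := by
  have hres : ∀ t, 0 ≤ t → resolventForm U V p q t ≤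
      ∑ k, w k * resolventForm (Us k) (Vs k) (ps k) (qs k) t := by
    intro t ht
    obtain ⟨Y, hY⟩ := exists_variationalForm_eq hρ hσ hp hq ht
    rw [← hY, hρ_sum, hσ_sum, variationalForm_sum]
    exact Finset.sum_le_sum fun k _ => mul_le_mul_of_nonneg_left
      (variationalForm_le (hρs k) (hσs k) (hps k) (hqs k) ht Y) (hw k)
  set G : ℝ → ℝ := fun t =>
    ∑ k, w k * logForm (Us k) (Vs k) (ps k) (qs k) t - logForm U V p q t with hG
  have hderiv : ∀ t, 0 ≤ t → HasDerivAt G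
      (∑ k, w k * resolventForm (Us k) (Vs k) (ps k) (qs k) t - resolventForm U V p q t) t :=
    fun t ht => (HasDerivAt.fun_sum fun k _ =>
      (hasDerivAt_logForm (Us k) (Vs k) (hps k) (hqs k) ht).const_mul (w k)).sub
      (hasDerivAt_logForm U V hp hq ht)
  have hmono : MonotoneOn G (Set.Ici 0) := by
    refine monotoneOn_of_deriv_nonneg (convex_Ici 0)
      (fun t ht => (hderiv t ht).continuousAt.continuousWithinAt) ?_ ?_
    · intro t ht
      exact (hderiv t (interior_subset ht)).differentiableAt.differentiableWithinAt
    · intro t ht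
      rw [(hderiv t (interior_subset ht)).deriv]
      exact sub_nonneg.mpr (hres t (interior_subset ht))
  have hG0 : ∀ t, 0 ≤ t → 0 ≤ G t := by
    intro t ht
    have := hmono Set.self_mem_Ici ht ht
    simpa [hG, logForm_zero] using this
  have htr : ρ.trace.re = ∑ k, w k * (ρs k).trace.re := by
    rw [hρ_sum, Matrix.trace_sum, Complex.re_sum]
    simp
  refine le_of_tendsto_of_tendsto (tendsto_logForm hρ hσ hp)
    (tendsto_finsetSum Finset.univ fun k _ =>
      (tendsto_logForm (hρs k) (hσs k) (hps k)).const_mul (w k)) ?_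
  filter_upwards [Filter.eventually_ge_atTop 0] with t ht
  have := hG0 t ht
  simp only [hG] at this
  simp only [mul_sub, Finset.sum_sub_distrib, ← mul_assoc, ← Finset.sum_mul, ← htr]
  linarith

end Convexity

theorem ptraceLeft_eq_sum {X Y : Type*} [Fintype X] (ρ : Matrix (X × Y) (X × Y) ℂ) :
    ptraceLeft ρ = ∑ x, ρ.submatrix (Prod.mk x) (Prod.mk x) := by
  ext y y'
  simp [ptraceLeft, Matrix.sum_apply]

theorem ptraceLeft_sum {X Y ι : Type*} [Fintype X] [Fintype ι] (w : ι → ℝ)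
    (ρs : ι → Matrix (X × Y) (X × Y) ℂ) :
    ptraceLeft (∑ k, w k • ρs k) = ∑ k, w k • ptraceLeft (ρs k) := by
  ext y y'
  simp only [ptraceLeft, Matrix.sum_apply, Matrix.smul_apply, Finset.smul_sum]
  exact Finset.sum_comm

theorem Matrix.PosSemidef.ptraceLeft {X Y : Type*} [Fintype X] {ρ : Matrix (X × Y) (X × Y) ℂ} (h : ρ.PosSemidef) :
    (ptraceLeft ρ).PosSemidef := by
  rw [ptraceLeft_eq_sum]
  exact Matrix.posSemidef_sum _ fun x _ => h.submatrix _

theorem ptraceLeft_kronecker_conj {X Y : Type*} [Fintype X] [Fintype Y] [DecidableEq X]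
    (ρ : Matrix (X × Y) (X × Y) ℂ) (W : Matrix Y Y ℂ) :
    ptraceLeft (((1 : Matrix X X ℂ) ⊗ₖ W)ᴴ * ρ * ((1 : Matrix X X ℂ) ⊗ₖ W)) =
      Wᴴ * ptraceLeft ρ * W := by
  ext y y'
  simp only [ptraceLeft, Matrix.mul_apply, Fintype.sum_prod_type, conjTranspose_apply,
    kroneckerMap_apply, Matrix.one_apply, ite_mul, one_mul, zero_mul, mul_ite, mul_zero,
    apply_ite star, star_zero, Finset.sum_ite_eq', Finset.sum_ite_irrel,
    Finset.sum_const_zero, Finset.mem_univ, if_true, Finset.sum_mul, Finset.mul_sum]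
  rw [Finset.sum_comm]
  refine Finset.sum_congr rfl fun j _ => ?_
  rw [Finset.sum_comm]

section ConditionalEntropy

variable {X Y : Type*} [Fintype X] [Fintype Y] [DecidableEq X] [DecidableEq Y]

theorem IsSpectralDecomp.one_kronecker_add {τ W : Matrix Y Y ℂ} {r : Y → ℝ}
    (h : IsSpectralDecomp τ W r) (ε : ℝ) :
    IsSpectralDecomp ((1 : Matrix X X ℂ) ⊗ₖ (τ + ε • (1 : Matrix Y Y ℂ)))
      ((1 : Matrix X X ℂ) ⊗ₖ W) (fun x => r x.2 + ε) where
  unitary := by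
    rw [conjTranspose_kronecker, ← mul_kronecker_mul, h.unitary]
    simp
  eq := by
    have hd : diagonal (fun x : X × Y => ((r x.2 + ε : ℝ) : ℂ)) =
        (1 : Matrix X X ℂ) ⊗ₖ (diagonal (fun y => (r y : ℂ)) + ε • (1 : Matrix Y Y ℂ)) := by
      ext ⟨x, y⟩ ⟨x', y'⟩
      by_cases hx : x = x' <;> by_cases hy : y = y' <;>
        simp [hx, hy]
    rw [hd, conjTranspose_kronecker, ← mul_kronecker_mul, ← mul_kronecker_mul, Matrix.mul_add,
      Matrix.add_mul, ← h.eq]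
    simp [h.unitary']

theorem entropy_eq {n : Type*} [Fintype n] [DecidableEq n] {ρ : Matrix n n ℂ}
    (h : ρ.IsHermitian) :
    entropy ρ = -∑ i, h.eigenvalues i * Real.log (h.eigenvalues i) :=
  dif_pos h

theorem relEntForm_one_kronecker {ρ U : Matrix (X × Y) (X × Y) ℂ} {p : X × Y → ℝ}
    {W : Matrix Y Y ℂ} {r : Y → ℝ} (hρ : IsSpectralDecomp ρ U p)
    (hτ : IsSpectralDecomp (ptraceLeft ρ) W r) (ε : ℝ) :
    relEntForm U ((1 : Matrix X X ℂ) ⊗ₖ W) p (fun x => r x.2 + ε) =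
      ∑ i, p i * Real.log (p i) - ∑ y, r y * Real.log (r y + ε) := by
  have h1 : ∑ i, p i * Real.log (p i) = ∑ i, ∑ j,
      Complex.normSq ((Uᴴ * ((1 : Matrix X X ℂ) ⊗ₖ W)) i j) * (p i * Real.log (p i)) := by
    simp only [← Finset.sum_mul, hρ.sum_normSq_overlap (hτ.one_kronecker_add ε), one_mul]
  have h2 : ∀ y, r y = ∑ x, ∑ i,
      Complex.normSq ((Uᴴ * ((1 : Matrix X X ℂ) ⊗ₖ W)) i (x, y)) * p i := by
    intro y
    have h := congrArg Complex.re
      (congrFun (congrFun (ptraceLeft_kronecker_conj ρ W) y) y)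
    have h' : Wᴴ * ptraceLeft ρ * W = diagonal (fun i => (r i : ℂ)) := by
      rw [hτ.eq]
      simp only [Matrix.mul_assoc, hτ.unitary, Matrix.mul_one]
      rw [← Matrix.mul_assoc, hτ.unitary, Matrix.one_mul]
    rw [h', ptraceLeft, Complex.re_sum, Matrix.diagonal_apply_eq, Complex.ofReal_re] at h
    rw [← h]
    exact Finset.sum_congr rfl fun x _ => hρ.conj_apply_self_re _ _
  have h3 : ∑ y, r y * Real.log (r y + ε) = ∑ i, ∑ j : X × Y,
      Complex.normSq ((Uᴴ * ((1 : Matrix X X ℂ) ⊗ₖ W)) i j) *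
        (p i * Real.log (r j.2 + ε)) := by
    rw [Finset.sum_comm, Fintype.sum_prod_type_right]
    refine Finset.sum_congr rfl fun y _ => ?_
    simp only [← mul_assoc, ← Finset.sum_mul, ← h2 y]
  rw [h1, h3, relEntForm]
  simp only [← Finset.sum_sub_distrib, mul_sub]

theorem tendsto_relEntForm_one_kronecker {ρ : Matrix (X × Y) (X × Y) ℂ} (h : ρ.PosSemidef) :
    Filter.Tendsto (fun ε : ℝ => relEntForm (h.1.eigenvectorUnitary : Matrix (X × Y) (X × Y) ℂ)
      ((1 : Matrix X X ℂ) ⊗ₖ (h.ptraceLeft.1.eigenvectorUnitary : Matrix Y Y ℂ))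
      h.1.eigenvalues (fun x => h.ptraceLeft.1.eigenvalues x.2 + ε))
      (nhdsWithin 0 (Set.Ioi 0)) (nhds (-condEnt ρ)) := by
  simp only [relEntForm_one_kronecker h.1.isSpectralDecomp h.ptraceLeft.1.isSpectralDecomp,
    condEnt, entropy_eq h.1, entropy_eq h.ptraceLeft.1, sub_neg_eq_add, neg_add, neg_neg,
    ← sub_eq_add_neg]
  refine Filter.Tendsto.const_sub _ (tendsto_finsetSum _ fun y _ => ?_)
  generalize h.ptraceLeft.1.eigenvalues y = r
  rcases eq_or_ne r 0 with h0 | h0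
  · simp [h0]
  refine Filter.Tendsto.const_mul _ (Filter.Tendsto.log ?_ h0)
  have hc : Filter.Tendsto (fun ε : ℝ => r + ε) (nhds 0) (nhds (r + 0)) :=
    (continuous_const_add r).tendsto 0
  rw [add_zero] at hc
  exact hc.mono_left nhdsWithin_le_nhds

/-- Concavity of the quantum conditional entropy. -/
theorem condEnt_concave {ι : Type*} [Fintype ι] {w : ι → ℝ} (hw : ∀ k, 0 ≤ w k)
    (hw1 : ∑ k, w k = 1) {ρ : Matrix (X × Y) (X × Y) ℂ} {ρs : ι → Matrix (X × Y) (X × Y) ℂ}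
    (hρs : ∀ k, (ρs k).PosSemidef) (hρ_sum : ρ = ∑ k, w k • ρs k) :
    ∑ k, w k * condEnt (ρs k) ≤ condEnt ρ := by
  have hρ : ρ.PosSemidef := by
    rw [hρ_sum]
    exact Matrix.posSemidef_sum _ fun k _ => (hρs k).smul (hw k)
  have key : -condEnt ρ ≤ ∑ k, w k * -condEnt (ρs k) := by
    refine le_of_tendsto_of_tendsto (tendsto_relEntForm_one_kronecker hρ)
      (tendsto_finsetSum Finset.univ fun k _ =>
        (tendsto_relEntForm_one_kronecker (hρs k)).const_mul (w k)) ?_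
    filter_upwards [self_mem_nhdsWithin] with ε hε
    refine relEntForm_convex hw hρ.1.isSpectralDecomp
      (hρ.ptraceLeft.1.isSpectralDecomp.one_kronecker_add ε)
      (fun k => (hρs k).1.isSpectralDecomp)
      (fun k => (hρs k).ptraceLeft.1.isSpectralDecomp.one_kronecker_add ε)
      hρ.eigenvalues_nonneg
      (fun j => add_pos_of_nonneg_of_pos (hρ.ptraceLeft.eigenvalues_nonneg _) hε)
      (fun k => (hρs k).eigenvalues_nonneg)
      (fun k j => add_pos_of_nonneg_of_pos ((hρs k).ptraceLeft.eigenvalues_nonneg _) hε)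
      hρ_sum ?_
    have hτ : ptraceLeft ρ + ε • (1 : Matrix Y Y ℂ) =
        ∑ k, w k • (ptraceLeft (ρs k) + ε • (1 : Matrix Y Y ℂ)) := by
      simp only [smul_add, Finset.sum_add_distrib, ← Finset.sum_smul, hw1, one_smul]
      rw [hρ_sum, ptraceLeft_sum]
    rw [hτ]
    ext x x'
    simp only [kroneckerMap_apply, Matrix.sum_apply, Matrix.smul_apply, Finset.mul_sum,
      mul_smul_comm]
  simp only [mul_neg, Finset.sum_neg_distrib] at key
  linarith

end ConditionalEntropy

theorem Matrix.PosSemidef.margAB {A B C : Type*} [Fintype C]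
    {ρ : Matrix (A × B × C) (A × B × C) ℂ} (h : ρ.PosSemidef) :
    (margAB ρ).PosSemidef := by
  have : _root_.margAB ρ =
      ∑ c, ρ.submatrix (fun x : A × B => (x.1, x.2, c)) (fun x => (x.1, x.2, c)) := by
    ext x y
    simp [_root_.margAB, Matrix.sum_apply]
  rw [this]
  exact Matrix.posSemidef_sum _ fun c _ => h.submatrix _

theorem Matrix.PosSemidef.margAC {A B C : Type*} [Fintype B]
    {ρ : Matrix (A × B × C) (A × B × C) ℂ} (h : ρ.PosSemidef) :
    (margAC ρ).PosSemidef := by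
  have : _root_.margAC ρ =
      ∑ b, ρ.submatrix (fun x : A × C => (x.1, b, x.2)) (fun x => (x.1, b, x.2)) := by
    ext x y
    simp [_root_.margAC, Matrix.sum_apply]
  rw [this]
  exact Matrix.posSemidef_sum _ fun b _ => h.submatrix _

theorem margAB_sum {A B C ι : Type*} [Fintype C] [Fintype ι] (w : ι → ℝ)
    (ρs : ι → Matrix (A × B × C) (A × B × C) ℂ) :
    margAB (∑ k, w k • ρs k) = ∑ k, w k • margAB (ρs k) := by
  ext x y
  simp only [margAB, Matrix.sum_apply, Matrix.smul_apply, Finset.smul_sum]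
  exact Finset.sum_comm

theorem margAC_sum {A B C ι : Type*} [Fintype B] [Fintype ι] (w : ι → ℝ)
    (ρs : ι → Matrix (A × B × C) (A × B × C) ℂ) :
    margAC (∑ k, w k • ρs k) = ∑ k, w k • margAC (ρs k) := by
  ext x y
  simp only [margAC, Matrix.sum_apply, Matrix.smul_apply, Finset.smul_sum]
  exact Finset.sum_comm

theorem Ta_eq_condEnt_add_condEnt {A B C : Type*}
    [Fintype A] [Fintype B] [Fintype C] [DecidableEq A] [DecidableEq B] [DecidableEq C]
    (ρ : Matrix (A × B × C) (A × B × C) ℂ) :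
    Ta ρ = condEnt (margAB ρ) + condEnt (margAC ρ) := by
  have hB : ptraceLeft (margAB ρ) = margB ρ := rfl
  have hC : ptraceLeft (margAC ρ) = margC ρ := rfl
  rw [Ta, condEnt, condEnt, hB, hC]
  ring

/-- `T^(a)` is concave on states: if `ρ_ABC = ∑ₖ pₖ ρᵏ_ABC` is a
convex combination of states, then `T^(a)(ρ_ABC) ≥ ∑ₖ pₖ T^(a)(ρᵏ_ABC)`. -/
theorem Ta_concave {A B C : Type*} [Fintype A] [Fintype B] [Fintype C]
    [DecidableEq A] [DecidableEq B] [DecidableEq C]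
    (ρ : Matrix (A × B × C) (A × B × C) ℂ) (hρ : IsState ρ)
    (K : ℕ) (p : Fin K → ℝ) (ρs : Fin K → Matrix (A × B × C) (A × B × C) ℂ)
    (hp : ∀ k, 0 ≤ p k) (hp1 : ∑ k, p k = 1)
    (hs : ∀ k, IsState (ρs k)) (hdec : ρ = ∑ k, p k • ρs k) :
    ∑ k, p k * Ta (ρs k) ≤ Ta ρ := by
  simp only [Ta_eq_condEnt_add_condEnt, mul_add, Finset.sum_add_distrib]
  exact add_le_add
    (condEnt_concave hp hp1 (fun k => (hs k).1.margAB) (by rw [hdec, margAB_sum]))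
    (condEnt_concave hp hp1 (fun k => (hs k).1.margAC) (by rw [hdec, margAC_sum]))

end
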